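/- Let 0<q<1 be real, h'1,h'2,h'3,l'1,l'2,l'3,α',β',μ0,α real, t1,t2,t3,ξ nonzero complex numbers and E' ∈ ℂ. Set λ = (h'1+h'2+h'3−l'1−l'2−l'3−2α'+β'+2)/2, χ = (l'1+l'2+l'3−h'1−h'2−h'3−β')/2, E = q^{2μ0+α−α'+χ}·E', μ = μ0+1+χ, β = −β'−χ, l_i = l'_i+μ0 and h_i = h'_i+μ0+χ for i=1,2,3. Assume h satisfies (A⟨3⟩(s; h'1,h'2,h'3,l'1,l'2,l'3,α',β')h)(s) = E'·h(s) for all s ∈ {q^{n}ξ : n∈ℤ}, that h(q^{L}ξ)/(q^{L}ξ)^{λ} → 0 as L → +∞, and that h(q^{K}ξ)/(q^{K}ξ)^{−α'−1} → 0 as K → −∞. Then for every nonzero complex x with x ∉ {q^{μ0+n}ξ : n∈ℤ}, the Jackson integral g(x) = x^{−α}·∫₀^{ξ∞} s^{−λ}·h(s)·P¹_{μ,μ0}(x,s) d_q s converges and satisfies (A⟨3⟩(x; h1,h2,h3,l1,l2,l3,α,β)g)(x) = E·g(x). -/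

import Mathlib

open Filter Topology

/-- The infinite q-Pochhammer symbol `(a;q)_∞ = ∏_{j=0}^∞ (1 - q^j a)`. -/
noncomputable def qPochInf (q : ℝ) (a : ℂ) : ℂ := ∏' j : ℕ, (1 - (q : ℂ) ^ j * a)

/-- `q^r` for a real exponent `r`, using the principal branch of the complex power. -/
noncomputable def qpow (q : ℝ) (r : ℝ) : ℂ := (q : ℂ) ^ (r : ℂ)

/-- The third degenerate Ruijsenaars–van Diejen operator `A⟨3⟩` applied to `g` at `x`. -/
noncomputable def A3 (q : ℝ) (t1 t2 t3 : ℂ) (h1 h2 h3 l1 l2 l3 a b : ℝ) (g : ℂ → ℂ) (x : ℂ) : ℂ :=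
  x⁻¹ * ((x - qpow q (h1 + 1/2) * t1) * (x - qpow q (h2 + 1/2) * t2) * (x - qpow q (h3 + 1/2) * t3)) *
      g (x / (q : ℂ))
    + qpow q (2*a + 1) * x⁻¹ *
        ((x - qpow q (l1 - 1/2) * t1) * (x - qpow q (l2 - 1/2) * t2) * (x - qpow q (l3 - 1/2) * t3)) *
        g ((q : ℂ) * x)
    + qpow q (a + 1/2) *
        (-(qpow q (1/2) + qpow q (-(1/2))) * x ^ 2
          + ((qpow q h1 + qpow q l1) * t1 + (qpow q h2 + qpow q l2) * t2
              + (qpow q h3 + qpow q l3) * t3) * x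
          + qpow q ((l1 + l2 + l3 + h1 + h2 + h3) / 2) * (qpow q (b / 2) + qpow q (-(b / 2))) *
              t1 * t2 * t3 * x⁻¹) * g x

/-- `P¹_{μ,μ0}(x,s) = (q^μ s/x;q)_∞ / (q^{μ0} s/x;q)_∞`. -/
noncomputable def P1 (q μ μ0 : ℝ) (x s : ℂ) : ℂ :=
  qPochInf q (qpow q μ * s / x) / qPochInf q (qpow q μ0 * s / x)

/-- The bilateral series `Σ_{n∈ℤ} f n` converges to `S`: the series over `n ≥ 0` and the
series over `n < 0` both converge, with sum `S`. -/
def HasBilatSum (f : ℤ → ℂ) (S : ℂ) : Prop :=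
  ∃ Sp Sm : ℂ,
    Filter.Tendsto (fun N : ℕ => ∑ n ∈ Finset.range N, f n) Filter.atTop (nhds Sp) ∧
    Filter.Tendsto (fun N : ℕ => ∑ n ∈ Finset.range N, f (-(n : ℤ) - 1)) Filter.atTop (nhds Sm) ∧
    S = Sp + Sm

/-- The kernel `P¹` intertwines the operator in `x` with the adjoint operator in `s`: here `P`, `p`,
`p'` stand for its values at `q s`, `s`, `s / q`, and `Q = q^{1/2}`. -/
lemma kernel_identity {x s Q m X b T1 T2 T3 S1 S2 S3 P p p' : ℂ}
    (hx : x ≠ 0) (hs : s ≠ 0) (hQ : Q ≠ 0)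
    (hP : (x - m * X * Q ^ 2 * s) * P = (x - m * s) * p)
    (hp : (x - m * s / Q ^ 2) * p' = (x - m * X * s) * p)
    (hS : S1 * S2 * S3 = X ^ 2 * b * (T1 * T2 * T3)) :
    s * (x⁻¹ * ((x - m * X * Q * T1) * (x - m * X * Q * T2) * (x - m * X * Q * T3)) * P
        + Q ^ 2 * x⁻¹ * ((x - m * S1 / Q) * (x - m * S2 / Q) * (x - m * S3 / Q)) * p'
        + Q * (-(Q + Q⁻¹) * x ^ 2 + m * (X * (T1 + T2 + T3) + (S1 + S2 + S3)) * x
            + T1 * T2 * T3 * X * m ^ 3 * (X + b * X ^ 2) * x⁻¹) * p)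
      = m ^ 2 * X ^ 2 / Q ^ 2 *
          ((Q ^ 2 * s - Q * T1) * (Q ^ 2 * s - Q * T2) * (Q ^ 2 * s - Q * T3)) * P
        + m ^ 2 * Q ^ 4 * ((s / Q ^ 2 - S1 / Q) * (s / Q ^ 2 - S2 / Q) * (s / Q ^ 2 - S3 / Q)) * p'
        + m ^ 2 * X * Q * (-(Q + Q⁻¹) * s ^ 3 + ((T1 + T2 + T3) + (S1 + S2 + S3)) * s ^ 2
            + T1 * T2 * T3 * X * (b + 1)) * p := by
  linear_combination (norm := (field_simp; ring))
    s * (x + m * X * Q ^ 2 * s - m * X * Q * (T1 + T2 + T3)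
      + m ^ 2 * X ^ 2 * Q * (T1 * T2 * T3) / (x * s)) * hP
    + Q ^ 2 * s * (x + m * s / Q ^ 2 - m / Q * (S1 + S2 + S3)
      + m ^ 2 / Q * (S1 * S2 * S3) / (x * s)) * hp
    + m ^ 2 * Q * (1 - m * X * s / x) * p * hS

/-- A nonnegative sequence whose ratios are `|1 - q^k α| / |1 - q^k β|` is bounded. -/
lemma bounded_of_qratio {q : ℝ} (hq0 : 0 < q) (hq1 : q < 1) (α β : ℂ) (v : ℕ → ℝ)
    (hv : ∀ k, 0 ≤ v k)
    (hrec : ∀ k, ‖1 - (q : ℂ) ^ k * β‖ * v (k + 1) = ‖1 - (q : ℂ) ^ k * α‖ * v k) :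
    ∃ C, ∀ k, v k ≤ C := by
  set D : ℝ := 2 * (‖α‖ + ‖β‖) with hD
  have hlim : Tendsto (fun k : ℕ => q ^ k * ‖β‖) atTop (𝓝 0) := by
    simpa using (tendsto_pow_atTop_nhds_zero_of_lt_one hq0.le hq1).mul_const ‖β‖
  obtain ⟨N, hN⟩ := eventually_atTop.1
    (hlim.eventually (ge_mem_nhds (show (0:ℝ) < 1/2 by norm_num)))
  have hq1' : 0 < 1 - q := by linarith
  have hstep : ∀ k, N ≤ k → v (k + 1) * Real.exp (D * q ^ (k + 1) / (1 - q))
      ≤ v k * Real.exp (D * q ^ k / (1 - q)) := by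
    intro k hk
    have hB := hN k hk
    have hqk : 0 < q ^ k := pow_pos hq0 k
    have h1 : ‖1 - (q : ℂ) ^ k * α‖ ≤ 1 + q ^ k * ‖α‖ := by
      refine (norm_sub_le _ _).trans ?_
      simp [abs_of_pos hq0]
    have h2 : 1 - q ^ k * ‖β‖ ≤ ‖1 - (q : ℂ) ^ k * β‖ := by
      have := norm_sub_norm_le (1 : ℂ) ((q : ℂ) ^ k * β)
      simpa [abs_of_pos hq0] using this
    have h3 : v (k + 1) ≤ (1 + D * q ^ k) * v k := by
      have ha : (1 - q ^ k * ‖β‖) * v (k + 1) ≤ (1 + q ^ k * ‖α‖) * v k :=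
        ((mul_le_mul_of_nonneg_right h2 (hv _)).trans_eq (hrec k)).trans
          (mul_le_mul_of_nonneg_right h1 (hv _))
      have hA : 0 ≤ q ^ k * ‖α‖ := by positivity
      have hB0 : 0 ≤ q ^ k * ‖β‖ := by positivity
      have hb : 1 + q ^ k * ‖α‖ ≤ (1 - q ^ k * ‖β‖) * (1 + D * q ^ k) := by
        rw [hD]
        nlinarith
      have hc : (1 - q ^ k * ‖β‖) * v (k + 1)
          ≤ (1 - q ^ k * ‖β‖) * ((1 + D * q ^ k) * v k) := by
        rw [← mul_assoc]
        exact ha.trans (mul_le_mul_of_nonneg_right hb (hv _))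
      exact le_of_mul_le_mul_left hc (by linarith)
    have h4 : D * q ^ k / (1 - q) = D * q ^ k + D * q ^ (k + 1) / (1 - q) := by
      field_simp
      ring
    rw [h4, Real.exp_add, ← mul_assoc]
    refine mul_le_mul_of_nonneg_right (h3.trans ?_) (Real.exp_pos _).le
    rw [mul_comm]
    refine mul_le_mul_of_nonneg_left ?_ (hv _)
    linarith [Real.add_one_le_exp (D * q ^ k)]
  have hmono : ∀ j, v (N + j) * Real.exp (D * q ^ (N + j) / (1 - q))
      ≤ v N * Real.exp (D * q ^ N / (1 - q)) := by
    intro j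
    induction j with
    | zero => simp
    | succ j ih => exact (hstep (N + j) (by omega)).trans ih
  refine ⟨v N * Real.exp (D * q ^ N / (1 - q)) + ∑ i ∈ Finset.range N, v i, fun k => ?_⟩
  have hsum : 0 ≤ ∑ i ∈ Finset.range N, v i := Finset.sum_nonneg fun i _ => hv i
  rcases lt_or_ge k N with hk | hk
  · have := Finset.single_le_sum (fun i _ => hv i) (Finset.mem_range.2 hk)
    have h0 := mul_nonneg (hv N) (Real.exp_pos (D * q ^ N / (1 - q))).le
    linarith
  · obtain ⟨j, rfl⟩ := Nat.exists_eq_add_of_le hk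
    have hexp : 1 ≤ Real.exp (D * q ^ (N + j) / (1 - q)) := by
      apply Real.one_le_exp
      positivity
    nlinarith [hmono j, hv (N + j)]

lemma qPochInf_eq_one_sub_mul {q : ℝ} (hq0 : 0 < q) (hq1 : q < 1) (a : ℂ) :
    qPochInf q a = (1 - a) * qPochInf q (q * a) := by
  have hsum : Summable fun j : ℕ => ‖-((q : ℂ) ^ j * (q * a))‖ := by
    simp only [norm_neg, norm_mul, norm_pow, Complex.norm_real, Real.norm_eq_abs, abs_of_pos hq0]
    exact (summable_geometric_of_lt_one hq0.le hq1).mul_right _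
  have hmul := multipliable_one_add_of_summable hsum
  have hfun : (fun j : ℕ => 1 + -((q : ℂ) ^ j * (q * a)))
      = fun j : ℕ => 1 - (q : ℂ) ^ (j + 1) * a := by
    funext j
    ring
  rw [hfun] at hmul
  unfold qPochInf
  rw [tprod_eq_zero_mul' (f := fun j : ℕ => 1 - (q : ℂ) ^ j * a) hmul]
  simp only [pow_zero, one_mul]
  congr 2
  funext j
  ring

lemma P1_mul_one_sub {q : ℝ} (hq0 : 0 < q) (hq1 : q < 1) (μ μ0 : ℝ) {x s : ℂ}
    (hne : 1 - qpow q μ0 * s / x ≠ 0) :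
    (1 - qpow q μ * s / x) * P1 q μ μ0 x (q * s) = (1 - qpow q μ0 * s / x) * P1 q μ μ0 x s := by
  have hshift : ∀ r : ℝ, (q : ℂ) * (qpow q r * s / x) = qpow q r * (q * s) / x := fun r => by ring
  unfold P1
  rw [qPochInf_eq_one_sub_mul hq0 hq1 (qpow q μ * s / x),
    qPochInf_eq_one_sub_mul hq0 hq1 (qpow q μ0 * s / x), hshift, hshift, mul_div_mul_comm,
    ← mul_assoc (1 - qpow q μ0 * s / x), mul_div_cancel₀ _ hne]

lemma ofReal_mul_cpow {c : ℝ} (hc : 0 < c) {z : ℂ} (hz : z ≠ 0) (w : ℂ) :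
    ((c : ℂ) * z) ^ w = (c : ℂ) ^ w * z ^ w := by
  have hc' : (c : ℂ) ≠ 0 := by exact_mod_cast hc.ne'
  rw [Complex.cpow_def_of_ne_zero (mul_ne_zero hc' hz), Complex.cpow_def_of_ne_zero hc',
    Complex.cpow_def_of_ne_zero hz, Complex.log_ofReal_mul hc hz, ← Complex.exp_add,
    Complex.ofReal_log hc.le]
  ring_nf

lemma qpow_add {q : ℝ} (hq0 : 0 < q) (r r' : ℝ) : qpow q (r + r') = qpow q r * qpow q r' := by
  unfold qpow
  rw [Complex.ofReal_add, Complex.cpow_add _ _ (by exact_mod_cast hq0.ne')]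

lemma qpow_ne_zero {q : ℝ} (hq0 : 0 < q) (r : ℝ) : qpow q r ≠ 0 := by
  unfold qpow
  simp [Complex.cpow_eq_zero_iff, hq0.ne']

lemma qpow_neg (q r : ℝ) : qpow q (-r) = (qpow q r)⁻¹ := by
  unfold qpow
  rw [Complex.ofReal_neg, Complex.cpow_neg]

lemma qpow_one (q : ℝ) : qpow q 1 = q := by
  simp [qpow]

lemma qpow_intCast (q : ℝ) (n : ℤ) : qpow q n = (q : ℂ) ^ n := by
  simp [qpow]

lemma A3_congr {q : ℝ} {t1 t2 t3 : ℂ} {h1 h2 h3 l1 l2 l3 a b : ℝ} {g g' : ℂ → ℂ} {x : ℂ}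
    (hd : g (x / q) = g' (x / q)) (hu : g (q * x) = g' (q * x)) (hx : g x = g' x) :
    A3 q t1 t2 t3 h1 h2 h3 l1 l2 l3 a b g x = A3 q t1 t2 t3 h1 h2 h3 l1 l2 l3 a b g' x := by
  unfold A3
  rw [hd, hu, hx]

lemma A3_cpow_mul {q : ℝ} (hq0 : 0 < q) (t1 t2 t3 : ℂ) (h1 h2 h3 l1 l2 l3 a b r : ℝ)
    (φ : ℂ → ℂ) {x : ℂ} (hx : x ≠ 0) :
    A3 q t1 t2 t3 h1 h2 h3 l1 l2 l3 a b (fun y => y ^ (r : ℂ) * φ y) x =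
      x ^ (r : ℂ) * (
        x⁻¹ * ((x - qpow q (1 / 2) * (qpow q h1 * t1)) * (x - qpow q (1 / 2) * (qpow q h2 * t2)) *
            (x - qpow q (1 / 2) * (qpow q h3 * t3))) * ((qpow q r)⁻¹ * φ (x / q))
        + qpow q (2 * a + 1) * x⁻¹ * ((x - qpow q l1 * t1 / qpow q (1 / 2)) *
            (x - qpow q l2 * t2 / qpow q (1 / 2)) * (x - qpow q l3 * t3 / qpow q (1 / 2))) *
            (qpow q r * φ (q * x))
        + qpow q (a + 1 / 2) * (-(qpow q (1 / 2) + (qpow q (1 / 2))⁻¹) * x ^ 2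
          + ((qpow q h1 + qpow q l1) * t1 + (qpow q h2 + qpow q l2) * t2
              + (qpow q h3 + qpow q l3) * t3) * x
          + qpow q ((l1 + l2 + l3 + h1 + h2 + h3) / 2) * (qpow q (b / 2) + qpow q (-(b / 2))) *
              t1 * t2 * t3 * x⁻¹) * φ x) := by
  have hup : ((q : ℂ) * x) ^ (r : ℂ) = qpow q r * x ^ (r : ℂ) := ofReal_mul_cpow hq0 hx _
  have hdown : (x / (q : ℂ)) ^ (r : ℂ) = (qpow q r)⁻¹ * x ^ (r : ℂ) := by
    have hq : (q : ℂ) ≠ 0 := by exact_mod_cast hq0.ne'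
    have h := ofReal_mul_cpow hq0 (div_ne_zero hx hq) (r : ℂ)
    rw [mul_div_cancel₀ _ hq] at h
    rw [h, show (q : ℂ) ^ (r : ℂ) = qpow q r from rfl, inv_mul_cancel_left₀ (qpow_ne_zero hq0 r)]
  have hhalf : ∀ l : ℝ, qpow q (l - 1 / 2) = qpow q l / qpow q (1 / 2) := fun l => by
    rw [sub_eq_add_neg, qpow_add hq0, qpow_neg, ← div_eq_mul_inv]
  unfold A3
  simp only [hup, hdown, hhalf, qpow_neg q (1 / 2), qpow_add hq0 _ (1 / 2)]
  ring

lemma eq_zero_of_hasSum_telescope {G W : ℤ → ℂ} {S : ℂ} (hG : HasSum G S)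
    (hW : ∀ n, G n = W (n + 1) - W n) (htop : Tendsto W atTop (𝓝 0))
    (hbot : Tendsto W atBot (𝓝 0)) : S = 0 := by
  have hs := hG.summable
  have hpos : HasSum (fun n : ℕ => G n) (0 - W 0) := by
    have h1 : Summable fun n : ℕ => G n := hs.comp_injective Nat.cast_injective
    have h2 := h1.hasSum.tendsto_sum_nat
    have h3 : ∀ N : ℕ, ∑ n ∈ Finset.range N, G n = W N - W 0 := by
      intro N
      induction N with
      | zero => simp
      | succ N ih => rw [Finset.sum_range_succ, ih, hW]; push_cast; ring
    simp only [h3] at h2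
    have h4 := (htop.comp tendsto_natCast_atTop_atTop).sub_const (W 0)
    exact tendsto_nhds_unique h2 h4 ▸ h1.hasSum
  have hneg : HasSum (fun n : ℕ => G (-(n + 1 : ℤ))) (W 0 - 0) := by
    have h1 : Summable fun n : ℕ => G (-(n + 1 : ℤ)) :=
      hs.comp_injective fun m n h => by simpa using h
    have h2 := h1.hasSum.tendsto_sum_nat
    have h3 : ∀ N : ℕ, ∑ n ∈ Finset.range N, G (-(n + 1 : ℤ)) = W 0 - W (-N) := by
      intro N
      induction N with
      | zero => simp
      | succ N ih =>
        rw [Finset.sum_range_succ, ih, hW, show -((N : ℤ) + 1) + 1 = -N by ring]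
        push_cast
        ring
    simp only [h3] at h2
    have h4 := (hbot.comp
      (tendsto_neg_atTop_atBot.comp (tendsto_natCast_atTop_atTop (R := ℤ)))).const_sub (W 0)
    exact tendsto_nhds_unique h2 h4 ▸ h1.hasSum
  have := (HasSum.of_nat_of_neg_add_one hpos hneg).unique hG
  rw [← this]
  ring

lemma tendsto_int_atTop_of_nat {f : ℤ → ℂ} {c : ℂ}
    (h : Tendsto (fun k : ℕ => f k) atTop (𝓝 c)) : Tendsto f atTop (𝓝 c) := by
  rw [← Nat.map_cast_int_atTop]
  exact tendsto_map'_iff.2 h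

lemma tendsto_int_atBot_of_nat {f : ℤ → ℂ} {c : ℂ}
    (h : Tendsto (fun k : ℕ => f (-k)) atTop (𝓝 c)) : Tendsto f atBot (𝓝 c) := by
  have h' := (tendsto_int_atTop_of_nat (f := fun n => f (-n)) h).comp tendsto_neg_atBot_atTop
  refine h'.congr fun n => ?_
  simp

lemma tendsto_qzpow_atTop {q : ℝ} (hq0 : 0 < q) (hq1 : q < 1) (ξ : ℂ) :
    Tendsto (fun n : ℤ => (q : ℂ) ^ n * ξ) atTop (𝓝 0) := by
  have h : Tendsto (fun n : ℕ => ((q : ℂ) ^ (n : ℤ) * ξ)) atTop (𝓝 0) := by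
    have := (tendsto_pow_atTop_nhds_zero_of_norm_lt_one (x := (q : ℂ))
      (by simpa [abs_of_pos hq0] using hq1)).mul_const ξ
    simpa using this
  exact tendsto_int_atTop_of_nat h

lemma tendsto_qzpow_inv_atBot {q : ℝ} (hq0 : 0 < q) (hq1 : q < 1) (ξ : ℂ) :
    Tendsto (fun n : ℤ => ((q : ℂ) ^ n * ξ)⁻¹) atBot (𝓝 0) := by
  have h := (tendsto_qzpow_atTop hq0 hq1 ξ⁻¹).comp tendsto_neg_atBot_atTop
  refine h.congr fun n => ?_
  simp [mul_comm]

lemma tendsto_cubic_mul_atTop {q : ℝ} (hq0 : 0 < q) (hq1 : q < 1) {ξ : ℂ} (c d1 d2 d3 : ℂ)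
    {F : ℤ → ℂ} (hF : Tendsto F atTop (𝓝 0)) :
    Tendsto (fun n : ℤ => (c * ((q : ℂ) ^ n * ξ) - d1) * (c * ((q : ℂ) ^ n * ξ) - d2) *
      (c * ((q : ℂ) ^ n * ξ) - d3) * F n) atTop (𝓝 0) := by
  have h : ∀ d, Tendsto (fun n : ℤ => c * ((q : ℂ) ^ n * ξ) - d) atTop (𝓝 (c * 0 - d)) := fun d =>
    ((tendsto_qzpow_atTop hq0 hq1 ξ).const_mul c).sub_const d
  simpa using (((h d1).mul (h d2)).mul (h d3)).mul hF

lemma tendsto_cubic_mul_atBot {q : ℝ} (hq0 : 0 < q) (hq1 : q < 1) {ξ : ℂ} (hξ : ξ ≠ 0)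
    (c d1 d2 d3 : ℂ) {F : ℤ → ℂ}
    (hF : Tendsto (fun n : ℤ => ((q : ℂ) ^ n * ξ) ^ 3 * F n) atBot (𝓝 0)) :
    Tendsto (fun n : ℤ => (c * ((q : ℂ) ^ n * ξ) - d1) * (c * ((q : ℂ) ^ n * ξ) - d2) *
      (c * ((q : ℂ) ^ n * ξ) - d3) * F n) atBot (𝓝 0) := by
  have h : ∀ d, Tendsto (fun n : ℤ => c - d * ((q : ℂ) ^ n * ξ)⁻¹) atBot (𝓝 (c - d * 0)) :=
    fun d => ((tendsto_qzpow_inv_atBot hq0 hq1 ξ).const_mul d).const_sub c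
  have hlim := (((h d1).mul (h d2)).mul (h d3)).mul hF
  rw [mul_zero] at hlim
  refine hlim.congr fun n => ?_
  have hs : (q : ℂ) ^ n * ξ ≠ 0 := mul_ne_zero (zpow_ne_zero _ (by exact_mod_cast hq0.ne')) hξ
  generalize (q : ℂ) ^ n * ξ = s at hs
  field_simp

lemma summable_qzpow_mul {q : ℝ} (hq0 : 0 < q) (hq1 : q < 1) {ξ : ℂ} (hξ : ξ ≠ 0) {F : ℤ → ℂ}
    (htop : Tendsto F atTop (𝓝 0))
    (hbot : Tendsto (fun n : ℤ => ((q : ℂ) ^ n * ξ) ^ 3 * F n) atBot (𝓝 0)) :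
    Summable fun n : ℤ => (q : ℂ) ^ n * ξ * F n := by
  have hq : (q : ℂ) ≠ 0 := by exact_mod_cast hq0.ne'
  have hgeom := summable_geometric_of_lt_one hq0.le hq1
  apply Summable.of_nat_of_neg
  · have hO := (htop.comp (tendsto_natCast_atTop_atTop (R := ℤ))).isBigO_one ℝ
    refine summable_of_isBigO_nat hgeom (g := fun n : ℕ => q ^ n) ?_
    have h1 : (fun n : ℕ => (q : ℂ) ^ (n : ℤ) * ξ) =O[atTop] fun n : ℕ => q ^ n :=
      Asymptotics.IsBigO.of_bound ‖ξ‖ (.of_forall fun n => by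
        simp [mul_comm])
    simpa using h1.mul hO
  · have hO := (hbot.comp (tendsto_neg_atTop_atBot.comp
      (tendsto_natCast_atTop_atTop (R := ℤ)))).isBigO_one ℝ
    have hq2 : q ^ 2 < 1 := by nlinarith
    refine summable_of_isBigO_nat
      (summable_geometric_of_lt_one (sq_nonneg q) hq2) (g := fun n : ℕ => (q ^ 2) ^ n) ?_
    have h1 : (fun n : ℕ => (((q : ℂ) ^ (-(n : ℤ)) * ξ) ^ 2)⁻¹) =O[atTop]
        fun n : ℕ => (q ^ 2) ^ n :=
      Asymptotics.IsBigO.of_bound (‖ξ‖ ^ 2)⁻¹ (.of_forall fun n => by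
        simp [mul_pow, abs_of_pos hq0, ← pow_mul, mul_comm])
    refine (h1.mul hO).congr (fun n => ?_) fun n => by simp
    have hs : (q : ℂ) ^ (-(n : ℤ)) * ξ ≠ 0 := mul_ne_zero (zpow_ne_zero _ hq) hξ
    simp only [Function.comp]
    generalize (q : ℂ) ^ (-(n : ℤ)) * ξ = s at hs
    field_simp

lemma P1_bounded_nat {q : ℝ} (hq0 : 0 < q) (hq1 : q < 1) (μ μ0 : ℝ) {x ξ : ℂ}
    (hne : ∀ n : ℤ, 1 - qpow q μ0 * ((q : ℂ) ^ n * ξ) / x ≠ 0) :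
    ∃ C, ∀ k : ℕ, ‖P1 q μ μ0 x ((q : ℂ) ^ (k : ℤ) * ξ)‖ ≤ C := by
  have hq : (q : ℂ) ≠ 0 := by exact_mod_cast hq0.ne'
  refine bounded_of_qratio hq0 hq1 (qpow q μ0 * ξ / x) (qpow q μ * ξ / x) _
    (fun k => norm_nonneg _) fun k => ?_
  have h := P1_mul_one_sub hq0 hq1 μ μ0 (hne k)
  rw [← mul_assoc (q : ℂ), ← zpow_one_add₀ hq] at h
  rw [← norm_mul, ← norm_mul, Nat.cast_succ, add_comm (k : ℤ), ← zpow_natCast (q : ℂ) k]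
  congr 1
  linear_combination h

lemma P1_bounded_neg {q : ℝ} (hq0 : 0 < q) (hq1 : q < 1) (μ μ0 : ℝ) {x ξ : ℂ} (hx : x ≠ 0)
    (hξ : ξ ≠ 0) (hne : ∀ n : ℤ, 1 - qpow q μ0 * ((q : ℂ) ^ n * ξ) / x ≠ 0) :
    ∃ C, ∀ k : ℕ, ‖P1 q μ μ0 x ((q : ℂ) ^ (-(k : ℤ)) * ξ) * qpow q (μ0 - μ) ^ k‖ ≤ C := by
  have hq : (q : ℂ) ≠ 0 := by exact_mod_cast hq0.ne'
  have hm := qpow_ne_zero hq0 μ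
  have hm0 := qpow_ne_zero hq0 μ0
  refine bounded_of_qratio hq0 hq1 (q * x / (qpow q μ * ξ)) (q * x / (qpow q μ0 * ξ)) _
    (fun k => norm_nonneg _) fun k => ?_
  have h := P1_mul_one_sub hq0 hq1 μ μ0 (hne (-((k : ℤ) + 1)))
  rw [← mul_assoc (q : ℂ), ← zpow_one_add₀ hq, show (1 : ℤ) + -(k + 1) = -k by ring] at h
  have hinv : (q : ℂ) ^ (-((k : ℤ) + 1)) = ((q : ℂ) ^ k * q)⁻¹ := by
    rw [zpow_neg, zpow_add_one₀ hq, zpow_natCast]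
  rw [← norm_mul, ← norm_mul]
  congr 1
  push_cast
  rw [pow_succ, sub_eq_add_neg μ0, qpow_add hq0, qpow_neg]
  generalize P1 q μ μ0 x ((q : ℂ) ^ (-(k : ℤ)) * ξ) = p at *
  generalize P1 q μ μ0 x ((q : ℂ) ^ (-((k : ℤ) + 1)) * ξ) = p' at *
  rw [hinv] at h
  generalize qpow q μ = m at *
  generalize qpow q μ0 = m0 at *
  have hk : (q : ℂ) ^ k ≠ 0 := pow_ne_zero _ hq
  generalize (m0 * m⁻¹) ^ k = d at *
  generalize (q : ℂ) ^ k = z at *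
  field_simp at h ⊢
  linear_combination d * h

lemma tendsto_mul_P1_atTop {q : ℝ} (hq0 : 0 < q) (hq1 : q < 1) (μ μ0 : ℝ) {x ξ : ℂ}
    (hne : ∀ n : ℤ, 1 - qpow q μ0 * ((q : ℂ) ^ n * ξ) / x ≠ 0) {u : ℤ → ℂ}
    (hu : Tendsto u atTop (𝓝 0)) :
    Tendsto (fun n : ℤ => u n * P1 q μ μ0 x ((q : ℂ) ^ n * ξ)) atTop (𝓝 0) := by
  obtain ⟨C, hC⟩ := P1_bounded_nat hq0 hq1 μ μ0 hne
  refine tendsto_int_atTop_of_nat ?_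
  exact (hu.comp (tendsto_natCast_atTop_atTop (R := ℤ))).zero_mul_isBoundedUnder_le
    (isBoundedUnder_of ⟨C, hC⟩)

lemma tendsto_mul_P1_atBot {q : ℝ} (hq0 : 0 < q) (hq1 : q < 1) (μ μ0 : ℝ) {x ξ : ℂ}
    (hx : x ≠ 0) (hξ : ξ ≠ 0) (hne : ∀ n : ℤ, 1 - qpow q μ0 * ((q : ℂ) ^ n * ξ) / x ≠ 0)
    {u : ℤ → ℂ}
    (hu : Tendsto (fun n : ℤ => u n * qpow q ((3 + μ0 - μ) * n)) atBot (𝓝 0)) :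
    Tendsto (fun n : ℤ => ((q : ℂ) ^ n * ξ) ^ 3 * (u n * P1 q μ μ0 x ((q : ℂ) ^ n * ξ)))
      atBot (𝓝 0) := by
  obtain ⟨C, hC⟩ := P1_bounded_neg hq0 hq1 μ μ0 hx hξ hne
  refine tendsto_int_atBot_of_nat ?_
  have h1 := ((hu.comp (tendsto_neg_atTop_atBot.comp
    (tendsto_natCast_atTop_atTop (R := ℤ)))).zero_mul_isBoundedUnder_le
      (isBoundedUnder_of ⟨C, hC⟩)).const_mul (ξ ^ 3)
  rw [mul_zero] at h1
  refine h1.congr fun k => ?_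
  have hk : qpow q (μ0 - μ) ^ k = qpow q ((μ0 - μ) * k) := by
    simp only [qpow]
    rw [← Complex.cpow_nat_mul]
    push_cast
    ring_nf
  have hz : ((q : ℂ) ^ (-(k : ℤ))) ^ 3
      = qpow q ((3 + μ0 - μ) * (-(k : ℤ) : ℤ)) * qpow q ((μ0 - μ) * k) := by
    rw [← qpow_add hq0, ← zpow_natCast, ← zpow_mul, ← qpow_intCast]
    congr 1
    push_cast
    ring
  simp only [Function.comp, hk, mul_pow, hz]
  ring

lemma qzpow_mul_cpow {q : ℝ} (hq0 : 0 < q) {ξ : ℂ} (hξ : ξ ≠ 0) (n : ℤ) (e : ℝ) :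
    ((q : ℂ) ^ n * ξ) ^ (e : ℂ) = qpow q (e * n) * ξ ^ (e : ℂ) := by
  have h := ofReal_mul_cpow (zpow_pos hq0 n) hξ (e : ℂ)
  rw [Complex.ofReal_zpow] at h
  rw [h, qpow, ← Complex.ofReal_zpow, ← Complex.ofReal_cpow (zpow_pos hq0 n).le,
    ← Complex.ofReal_cpow hq0.le, ← Real.rpow_intCast, ← Real.rpow_mul hq0.le, mul_comm e]

lemma hasBilatSum_of_hasSum {f : ℤ → ℂ} {S : ℂ} (hf : HasSum f S) : HasBilatSum f S := by
  have hpos : Summable fun n : ℕ => f n := hf.summable.comp_injective Nat.cast_injective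
  have hneg : Summable fun n : ℕ => f (-(n + 1 : ℤ)) :=
    hf.summable.comp_injective fun m n h => by simpa using h
  refine ⟨_, _, hpos.hasSum.tendsto_sum_nat, ?_,
    hf.unique (HasSum.of_nat_of_neg_add_one hpos.hasSum hneg.hasSum)⟩
  refine hneg.hasSum.tendsto_sum_nat.congr fun N => Finset.sum_congr rfl fun n _ => ?_
  rw [neg_add']

lemma one_sub_ne_zero_of_ne_qpow {q : ℝ} (hq0 : 0 < q) {μ0 : ℝ} {y ξ : ℂ} (hy : y ≠ 0)
    (hne : ∀ n : ℤ, y ≠ qpow q (μ0 + n) * ξ) (n : ℤ) :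
    1 - qpow q μ0 * ((q : ℂ) ^ n * ξ) / y ≠ 0 := by
  intro h
  apply hne n
  rw [qpow_add hq0, qpow_intCast]
  field_simp at h
  linear_combination h

lemma shift_ne_qpow {q : ℝ} (hq0 : 0 < q) {μ0 : ℝ} {y ξ : ℂ}
    (hne : ∀ n : ℤ, y ≠ qpow q (μ0 + n) * ξ) (k n : ℤ) :
    (q : ℂ) ^ k * y ≠ qpow q (μ0 + n) * ξ := by
  intro h
  apply hne (n - k)
  have hk : (q : ℂ) ^ k ≠ 0 := zpow_ne_zero _ (by exact_mod_cast hq0.ne')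
  apply mul_left_cancel₀ hk
  rw [h, ← qpow_intCast, ← mul_assoc, ← qpow_add hq0]
  congr 2
  push_cast
  ring

theorem stmt14 (q : ℝ) (hq0 : 0 < q) (hq1 : q < 1)
    (h1' h2' h3' l1' l2' l3' a' b' μ0 a : ℝ) (t1 t2 t3 ξ : ℂ)
    (ht1 : t1 ≠ 0) (ht2 : t2 ≠ 0) (ht3 : t3 ≠ 0) (hξ : ξ ≠ 0) (E' : ℂ)
    (lam χ μ b l1 l2 l3 h1 h2 h3 : ℝ) (E : ℂ)
    (hlam : lam = (h1' + h2' + h3' - l1' - l2' - l3' - 2 * a' + b' + 2) / 2)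
    (hχ : χ = (l1' + l2' + l3' - h1' - h2' - h3' - b') / 2)
    (hE : E = qpow q (2 * μ0 + a - a' + χ) * E')
    (hμ : μ = μ0 + 1 + χ)
    (hb : b = -b' - χ)
    (hl1 : l1 = l1' + μ0) (hl2 : l2 = l2' + μ0) (hl3 : l3 = l3' + μ0)
    (hh1 : h1 = h1' + μ0 + χ) (hh2 : h2 = h2' + μ0 + χ) (hh3 : h3 = h3' + μ0 + χ)
    (h : ℂ → ℂ)
    (heig : ∀ n : ℤ, A3 q t1 t2 t3 h1' h2' h3' l1' l2' l3' a' b' h ((q : ℂ) ^ n * ξ)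
      = E' * h ((q : ℂ) ^ n * ξ))
    (hC1 : Filter.Tendsto
      (fun L : ℤ => h ((q : ℂ) ^ L * ξ) / ((q : ℂ) ^ L * ξ) ^ ((lam : ℝ) : ℂ))
      Filter.atTop (nhds 0))
    (hC2 : Filter.Tendsto
      (fun K : ℤ => h ((q : ℂ) ^ K * ξ) / ((q : ℂ) ^ K * ξ) ^ ((-a' - 1 : ℝ) : ℂ))
      Filter.atBot (nhds 0)) :
    ∃ J : ℂ → ℂ,
      (∀ y : ℂ, y ≠ 0 → (∀ n : ℤ, y ≠ qpow q (μ0 + n) * ξ) →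
        HasBilatSum (fun n : ℤ =>
          (1 - (q : ℂ)) * ((q : ℂ) ^ n * ξ) *
            (((q : ℂ) ^ n * ξ) ^ ((-lam : ℝ) : ℂ) * h ((q : ℂ) ^ n * ξ) *
              P1 q μ μ0 y ((q : ℂ) ^ n * ξ))) (J y)) ∧
      (∀ x : ℂ, x ≠ 0 → (∀ n : ℤ, x ≠ qpow q (μ0 + n) * ξ) →
        A3 q t1 t2 t3 h1 h2 h3 l1 l2 l3 a b (fun y => y ^ ((-a : ℝ) : ℂ) * J y) x
          = E * (x ^ ((-a : ℝ) : ℂ) * J x)) := by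
  have hq : (q : ℂ) ≠ 0 := by exact_mod_cast hq0.ne'
  set s : ℤ → ℂ := fun n => (q : ℂ) ^ n * ξ with hs_def
  have hs : ∀ n, s n ≠ 0 := fun n => mul_ne_zero (zpow_ne_zero _ hq) hξ
  have hs_succ : ∀ n, (q : ℂ) * s n = s (n + 1) := fun n => by
    simp only [hs_def, zpow_add_one₀ hq]
    ring
  have hs_pred : ∀ n, s n / (q : ℂ) = s (n - 1) := fun n => by
    simp only [hs_def, zpow_sub_one₀ hq]
    ring
  set φ : ℂ → ℂ := fun y => y ^ ((-lam : ℝ) : ℂ) * h y with hφ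
  have hφh : ∀ y, y ≠ 0 → h y = y ^ (lam : ℂ) * φ y := fun y hy => by
    simp only [hφ, Complex.ofReal_neg, Complex.cpow_neg]
    rw [mul_inv_cancel_left₀ (by simp [Complex.cpow_eq_zero_iff, hy])]
  set u : ℤ → ℂ := fun n => φ (s n) with hu_def
  have hu_top : Tendsto u atTop (𝓝 0) := by
    refine hC1.congr fun n => ?_
    simp only [hu_def, hφ, Complex.ofReal_neg, Complex.cpow_neg]
    exact div_eq_inv_mul _ _
  have hu_bot : Tendsto (fun n : ℤ => u n * qpow q ((3 + μ0 - μ) * n)) atBot (𝓝 0) := by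
    have h1 := hC2.mul_const (ξ ^ (((3 + μ0 - μ : ℝ) : ℂ)))⁻¹
    rw [zero_mul] at h1
    refine h1.congr fun n => ?_
    have h2 := qzpow_mul_cpow hq0 hξ n (3 + μ0 - μ)
    have hξe : ξ ^ ((3 + μ0 - μ : ℝ) : ℂ) ≠ 0 := by simp [Complex.cpow_eq_zero_iff, hξ]
    have h3 : s n ^ ((3 + μ0 - μ : ℝ) : ℂ)
        = s n ^ (lam : ℂ) / s n ^ ((-a' - 1 : ℝ) : ℂ) := by
      rw [← Complex.cpow_sub _ _ (hs n), ← Complex.ofReal_sub]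
      congr 2
      rw [hlam, hμ, hχ]
      ring
    change h (s n) / s n ^ ((-a' - 1 : ℝ) : ℂ) * (ξ ^ ((3 + μ0 - μ : ℝ) : ℂ))⁻¹ = _
    rw [← div_eq_mul_inv, div_eq_iff hξe, mul_assoc, ← h2, hφh _ (hs n)]
    change _ = u n * s n ^ ((3 + μ0 - μ : ℝ) : ℂ)
    rw [h3]
    ring
  have tails : ∀ y : ℂ, y ≠ 0 → (∀ n : ℤ, y ≠ qpow q (μ0 + n) * ξ) →
      Tendsto (fun n => u n * P1 q μ μ0 y (s n)) atTop (𝓝 0) ∧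
      Tendsto (fun n => s n ^ 3 * (u n * P1 q μ μ0 y (s n))) atBot (𝓝 0) := fun y hy hne =>
    ⟨tendsto_mul_P1_atTop hq0 hq1 μ μ0 (one_sub_ne_zero_of_ne_qpow hq0 hy hne) hu_top,
      tendsto_mul_P1_atBot hq0 hq1 μ μ0 hy hξ (one_sub_ne_zero_of_ne_qpow hq0 hy hne) hu_bot⟩
  have summ : ∀ y : ℂ, y ≠ 0 → (∀ n : ℤ, y ≠ qpow q (μ0 + n) * ξ) →
      Summable fun n => s n * (u n * P1 q μ μ0 y (s n)) := fun y hy hne =>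
    summable_qzpow_mul hq0 hq1 hξ (tails y hy hne).1 (tails y hy hne).2
  refine ⟨fun y => (1 - (q : ℂ)) * ∑' n, s n * (u n * P1 q μ μ0 y (s n)), fun y hy hne => ?_,
    fun x hx hne => ?_⟩
  · convert hasBilatSum_of_hasSum ((summ y hy hne).hasSum.mul_left (1 - (q : ℂ))) using 2 with n
    exact mul_assoc _ _ _
  have hup : (q : ℂ) * x ≠ 0 := mul_ne_zero hq hx
  have hdown : x / (q : ℂ) ≠ 0 := div_ne_zero hx hq
  have hne_up : ∀ n : ℤ, (q : ℂ) * x ≠ qpow q (μ0 + n) * ξ := fun n => by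
    simpa using shift_ne_qpow hq0 hne 1 n
  have hne_down : ∀ n : ℤ, x / (q : ℂ) ≠ qpow q (μ0 + n) * ξ := fun n => by
    simpa [div_eq_inv_mul] using shift_ne_qpow hq0 hne (-1) n
  have hP_up : ∀ n, P1 q μ μ0 (q * x) (s n) = P1 q μ μ0 x (s (n - 1)) := fun n => by
    have hsh : ∀ r : ℝ, qpow q r * s n / (q * x) = qpow q r * s (n - 1) / x := fun r => by
      rw [← hs_pred]
      field_simp
    simp only [P1, hsh]
  have hP_down : ∀ n, P1 q μ μ0 (x / q) (s n) = P1 q μ μ0 x (s (n + 1)) := fun n => by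
    have hsh : ∀ r : ℝ, qpow q r * s n / (x / q) = qpow q r * s (n + 1) / x := fun r => by
      rw [← hs_succ]
      field_simp
    simp only [P1, hsh]
  have tail_up := tails _ hup hne_up
  have tail_down := tails _ hdown hne_down
  have sum0 := (summ x hx hne).hasSum
  have sum_up := (summ _ hup hne_up).hasSum
  have sum_down := (summ _ hdown hne_down).hasSum
  rw [A3_cpow_mul hq0 _ _ _ _ _ _ _ _ _ _ _ _ _ hx]
  beta_reduce
  generalize ∑' n, s n * (u n * P1 q μ μ0 x (s n)) = S0 at *
  generalize ∑' n, s n * (u n * P1 q μ μ0 (q * x) (s n)) = Sup at *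
  generalize ∑' n, s n * (u n * P1 q μ μ0 (x / q) (s n)) = Sdown at *
  simp only [hP_up] at sum_up tail_up
  simp only [hP_down] at sum_down tail_down
  set p : ℤ → ℂ := fun n => P1 q μ μ0 x (s n) with hp_def
  -- the powers of `q` entering the kernel identity
  set Q := qpow q (1 / 2) with hQ_def
  set m := qpow q μ0 with hm_def
  set X := qpow q χ with hX_def
  set B := qpow q b' with hB_def
  have hQ : Q ≠ 0 := qpow_ne_zero hq0 _
  have hQq : (q : ℂ) = Q ^ 2 := by
    rw [hQ_def, pow_two, ← qpow_add hq0, ← qpow_one q]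
    norm_num
  have hqμ : qpow q μ = m * X * Q ^ 2 := by
    rw [← hQq, ← qpow_one q, hm_def, hX_def, ← qpow_add hq0, ← qpow_add hq0]
    congr 1
    rw [hμ]
    ring
  set T1 := qpow q h1' * t1 with hT1
  set T2 := qpow q h2' * t2 with hT2
  set T3 := qpow q h3' * t3 with hT3
  set S1 := qpow q l1' * t1 with hS1
  set S2 := qpow q l2' * t2 with hS2
  set S3 := qpow q l3' * t3 with hS3
  have hprod : S1 * S2 * S3 = X ^ 2 * B * (T1 * T2 * T3) := by
    have : qpow q l1' * qpow q l2' * qpow q l3'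
        = X * X * B * qpow q h1' * qpow q h2' * qpow q h3' := by
      simp only [hX_def, hB_def, ← qpow_add hq0]
      congr 1
      rw [hχ]
      ring
    rw [hS1, hS2, hS3, hT1, hT2, hT3]
    linear_combination t1 * t2 * t3 * this
  have hconst' : qpow q ((l1' + l2' + l3' + h1' + h2' + h3') / 2)
      * (qpow q (b' / 2) + qpow q (-(b' / 2))) * t1 * t2 * t3 = T1 * T2 * T3 * X * (B + 1) := by
    have e1 : qpow q ((l1' + l2' + l3' + h1' + h2' + h3') / 2) * qpow q (b' / 2)
        = qpow q h1' * qpow q h2' * qpow q h3' * X * B := by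
      simp only [hX_def, hB_def, ← qpow_add hq0]
      congr 1
      rw [hχ]
      ring
    have e2 : qpow q ((l1' + l2' + l3' + h1' + h2' + h3') / 2) * qpow q (-(b' / 2))
        = qpow q h1' * qpow q h2' * qpow q h3' * X := by
      simp only [hX_def, ← qpow_add hq0]
      congr 1
      rw [hχ]
      ring
    rw [hT1, hT2, hT3]
    linear_combination t1 * t2 * t3 * (e1 + e2)
  have hconst : qpow q ((l1 + l2 + l3 + h1 + h2 + h3) / 2)
      * (qpow q (b / 2) + qpow q (-(b / 2))) * t1 * t2 * t3
      = T1 * T2 * T3 * X * m ^ 3 * (X + B * X ^ 2) := by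
    have e1 : qpow q ((l1 + l2 + l3 + h1 + h2 + h3) / 2) * qpow q (b / 2)
        = qpow q h1' * qpow q h2' * qpow q h3' * X * (m * m * m) * X := by
      simp only [hX_def, hm_def, ← qpow_add hq0]
      congr 1
      rw [hb, hl1, hl2, hl3, hh1, hh2, hh3, hχ]
      ring
    have e2 : qpow q ((l1 + l2 + l3 + h1 + h2 + h3) / 2) * qpow q (-(b / 2))
        = qpow q h1' * qpow q h2' * qpow q h3' * X * (m * m * m) * (B * (X * X)) := by
      simp only [hX_def, hm_def, hB_def, ← qpow_add hq0]
      congr 1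
      rw [hb, hl1, hl2, hl3, hh1, hh2, hh3, hχ]
      ring
    rw [hT1, hT2, hT3]
    linear_combination t1 * t2 * t3 * (e1 + e2)
  have hh : ∀ k : ℝ, qpow q (k + μ0 + χ) = m * X * qpow q k := fun k => by
    rw [qpow_add hq0, qpow_add hq0]
    ring
  have hl : ∀ k : ℝ, qpow q (k + μ0) = m * qpow q k := fun k => by
    rw [qpow_add hq0]
    ring
  set c := qpow q (2 * μ0 - a' + χ) with hc_def
  have hc1 : c * (qpow q lam)⁻¹ = m ^ 2 * X ^ 2 / Q ^ 2 := by
    rw [← hQq, ← qpow_one q, pow_two, pow_two, div_eq_mul_inv, ← qpow_neg, ← qpow_neg]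
    simp only [hX_def, hm_def, hc_def, ← qpow_add hq0]
    congr 1
    rw [hlam, hχ]
    ring
  have hc2 : c * qpow q (2 * a' + 1) * qpow q lam = m ^ 2 * Q ^ 4 := by
    rw [show Q ^ 4 = Q ^ 2 * Q ^ 2 by ring, ← hQq, ← qpow_one q, pow_two]
    simp only [hm_def, hc_def, ← qpow_add hq0]
    congr 1
    rw [hlam, hχ]
    ring
  have hc3 : c * qpow q (a' + 1 / 2) = m ^ 2 * X * Q := by
    rw [pow_two]
    simp only [hX_def, hm_def, hc_def, hQ_def, ← qpow_add hq0]
    congr 1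
    ring
  have hEc : E = qpow q a * c * E' := by
    rw [hE, hc_def, ← qpow_add hq0]
    congr 2
    ring
  -- the eigenvalue equation in terms of `u`
  have heig_u : ∀ n, c * E' * (s n * u n)
      = m ^ 2 * X ^ 2 / Q ^ 2 * ((s n - Q * T1) * (s n - Q * T2) * (s n - Q * T3)) * u (n - 1)
        + m ^ 2 * Q ^ 4 * ((s n - S1 / Q) * (s n - S2 / Q) * (s n - S3 / Q)) * u (n + 1)
        + m ^ 2 * X * Q * (-(Q + Q⁻¹) * s n ^ 3 + ((T1 + T2 + T3) + (S1 + S2 + S3)) * s n ^ 2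
            + T1 * T2 * T3 * X * (B + 1)) * u n := by
    intro n
    have h0 := heig n
    change A3 q t1 t2 t3 h1' h2' h3' l1' l2' l3' a' b' h (s n) = E' * h (s n) at h0
    rw [A3_congr (g' := fun y => y ^ (lam : ℂ) * φ y) (hφh _ (div_ne_zero (hs n) hq))
      (hφh _ (mul_ne_zero hq (hs n))) (hφh _ (hs n)), A3_cpow_mul hq0 _ _ _ _ _ _ _ _ _ _ _ _ _
      (hs n), hφh _ (hs n), hconst', hs_succ, hs_pred, mul_left_comm E'] at h0
    have h1 := mul_left_cancel₀ (by simp [Complex.cpow_eq_zero_iff, hs n]) h0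
    rw [← hc1, ← hc2, ← hc3]
    have hsn := hs n
    change _ = E' * u n at h1
    simp only [← hT1, ← hT2, ← hT3, ← hS1, ← hS2, ← hS3, ← hQ_def] at h1
    change _ * ((qpow q lam)⁻¹ * u (n - 1)) + _ * (qpow q lam * u (n + 1)) + _ * u n = _ at h1
    have hTS : (qpow q h1' + qpow q l1') * t1 + (qpow q h2' + qpow q l2') * t2
        + (qpow q h3' + qpow q l3') * t3 = (T1 + T2 + T3) + (S1 + S2 + S3) := by
      rw [hT1, hT2, hT3, hS1, hS2, hS3]
      ring
    rw [hTS] at h1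
    linear_combination (norm := (field_simp; ring)) (-(c * s n)) * h1
  have hrec : ∀ n, (x - m * X * Q ^ 2 * s n) * p (n + 1) = (x - m * s n) * p n := fun n => by
    have h0 := P1_mul_one_sub hq0 hq1 μ μ0 (one_sub_ne_zero_of_ne_qpow hq0 hx hne n)
    change (1 - qpow q μ * s n / x) * P1 q μ μ0 x (q * s n) = (1 - m * s n / x) * p n at h0
    rw [hs_succ, hqμ] at h0
    change _ * p (n + 1) = _ at h0
    field_simp at h0
    linear_combination h0
  have hs_mul : ∀ n, Q ^ 2 * s (n - 1) = s n := fun n => by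
    rw [← hQq, hs_succ, sub_add_cancel]
  have hs_div : ∀ n, (Q ^ 2)⁻¹ * s (n + 1) = s n := fun n => by
    rw [← hQq, inv_mul_eq_div, hs_pred, add_sub_cancel_right]
  have hrec' : ∀ n, (x - m * s n / Q ^ 2) * p (n - 1) = (x - m * X * s n) * p n := fun n => by
    have h0 := hrec (n - 1)
    rw [sub_add_cancel] at h0
    rw [← hs_mul n]
    field_simp
    linear_combination -h0
  -- boundary terms of the summation by parts
  set A : ℤ → ℂ := fun n => m ^ 2 * X ^ 2 / Q ^ 2 *
    ((Q ^ 2 * s n - Q * T1) * (Q ^ 2 * s n - Q * T2) * (Q ^ 2 * s n - Q * T3)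
      * (u n * p (n + 1))) with hA
  set C : ℤ → ℂ := fun n => m ^ 2 * Q ^ 4 *
    (((Q ^ 2)⁻¹ * s n - S1 / Q) * ((Q ^ 2)⁻¹ * s n - S2 / Q) * ((Q ^ 2)⁻¹ * s n - S3 / Q)
      * (u n * p (n - 1))) with hC
  have hA_top : Tendsto A atTop (𝓝 0) := by
    simpa only [mul_zero] using
      (tendsto_cubic_mul_atTop hq0 hq1 _ _ _ _ tail_down.1).const_mul (m ^ 2 * X ^ 2 / Q ^ 2)
  have hA_bot : Tendsto A atBot (𝓝 0) := by
    simpa only [mul_zero] using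
      (tendsto_cubic_mul_atBot hq0 hq1 hξ _ _ _ _ tail_down.2).const_mul (m ^ 2 * X ^ 2 / Q ^ 2)
  have hC_top : Tendsto C atTop (𝓝 0) := by
    simpa only [mul_zero] using
      (tendsto_cubic_mul_atTop hq0 hq1 _ _ _ _ tail_up.1).const_mul (m ^ 2 * Q ^ 4)
  have hC_bot : Tendsto C atBot (𝓝 0) := by
    simpa only [mul_zero] using
      (tendsto_cubic_mul_atBot hq0 hq1 hξ _ _ _ _ tail_up.2).const_mul (m ^ 2 * Q ^ 4)
  have key := eq_zero_of_hasSum_telescope (W := fun n => A (n - 1) - C n)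
    ((((sum_down.mul_left
        (x⁻¹ * ((x - m * X * Q * T1) * (x - m * X * Q * T2) * (x - m * X * Q * T3)))).add
      (sum_up.mul_left
        (Q ^ 2 * x⁻¹ * ((x - m * S1 / Q) * (x - m * S2 / Q) * (x - m * S3 / Q))))).add
      (sum0.mul_left (Q * (-(Q + Q⁻¹) * x ^ 2
        + m * (X * (T1 + T2 + T3) + (S1 + S2 + S3)) * x
        + T1 * T2 * T3 * X * m ^ 3 * (X + B * X ^ 2) * x⁻¹)))).sub
      (sum0.mul_left (c * E')))
    (fun n => by
      have hker := kernel_identity hx (hs n) hQ (hrec n) (hrec' n) hprod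
      have hu := heig_u n
      simp only [hA, hC, hs_mul, hs_div, add_sub_cancel_right, sub_add_cancel]
      linear_combination u n * hker - p n * hu)
    (by simpa [sub_eq_add_neg] using (hA_top.comp (tendsto_atTop_add_const_right _ (-1) tendsto_id)).sub hC_top)
    (by simpa [sub_eq_add_neg] using (hA_bot.comp (tendsto_atBot_add_const_right _ (-1) tendsto_id)).sub hC_bot)
  have ha1 : (qpow q (-a))⁻¹ = qpow q a := by rw [qpow_neg, inv_inv]
  have ha2 : qpow q (2 * a + 1) = qpow q a * qpow q a * Q ^ 2 := by
    rw [← hQq, ← qpow_one q, ← qpow_add hq0, ← qpow_add hq0]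
    congr 1
    ring
  have ha3 : qpow q a * qpow q (-a) = 1 := by
    rw [qpow_neg, mul_inv_cancel₀ (qpow_ne_zero hq0 a)]
  rw [hconst, hEc, ha1, ha2, qpow_add hq0 a, ← hQ_def, hl1, hl2, hl3, hh1, hh2, hh3]
  simp only [hh, hl]
  rw [hT1, hT2, hT3] at key ⊢
  rw [hS1, hS2, hS3] at key
  linear_combination x ^ ((-a : ℝ) : ℂ) * qpow q a * (1 - (q : ℂ)) * key
    + x ^ ((-a : ℝ) : ℂ) * qpow q a * Q ^ 2 * x⁻¹ * ((x - m * (qpow q l1' * t1) / Q) *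
      (x - m * (qpow q l2' * t2) / Q) * (x - m * (qpow q l3' * t3) / Q)) * (1 - (q : ℂ)) * Sup * ha3
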